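/- Let d ≥ 2, R ≥ 1 and n be positive integers with n > d·2^d·R + R. Let f = (f_1,…,f_R) be polynomials of degree d in n variables with real coefficients whose degree-d homogeneous parts F = (F_1,…,F_R) satisfy σ*(F) ≤ R − 1. Set 𝒞 = (n − R + 1/2)/2^d. Then 𝒞 > dR, and there exists a constant C > 0 depending only on f such that for every β ∈ ℝ^R and every real B ≥ 2, N^aux_{β·f}(B) ≤ C · B^{(d−1)n − 2^d·𝒞}. -/

import Mathlib

open MvPolynomial

noncomputable section

/-- Iterated partial derivative along a list of variable indices. -/
def iterPderiv {n : ℕ} {K : Type*} [CommSemiring K] (js : List (Fin n))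
    (f : MvPolynomial (Fin n) K) : MvPolynomial (Fin n) K :=
  js.foldr (fun j g => pderiv j g) f

/-- The system of multilinear forms `m^{(f)}`. -/
def mForm {K : Type*} [CommSemiring K] (d n : ℕ) (f : MvPolynomial (Fin n) K)
    (x : Fin (d - 1) → Fin n → K) : Fin n → K :=
  fun i => ∑ j : Fin (d - 1) → Fin n,
    (∏ k, x k (j k)) * eval (0 : Fin n → K) (pderiv i (iterPderiv (List.ofFn j) f))

/-- The `n × (d-1)n` Jacobian matrix `J^f` of `m^{(f)}`. -/
def jacMat {K : Type*} [CommSemiring K] (d n : ℕ) (f : MvPolynomial (Fin n) K)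
    (x : Fin (d - 1) → Fin n → K) : Matrix (Fin n) (Fin (d - 1) × Fin n) K :=
  fun i kl => mForm d n f (Function.update x kl.1 (Pi.single kl.2 1)) i

/-- σ*(H) for a system of complex forms. -/
def sigmaStar (d n R : ℕ) (H : Fin R → MvPolynomial (Fin n) ℂ) : ℕ :=
  sSup {s : ℕ | ∃ β : Fin R → ℂ, β ≠ 0 ∧ ∃ x : Fin (d - 1) → Fin n → ℂ,
    (∀ k, x k ≠ 0) ∧ mForm d n (∑ ρ, β ρ • H ρ) x = 0 ∧
    s = n - (jacMat d n (∑ ρ, β ρ • H ρ) x).rank}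

/-- σ* for a system with real coefficients. -/
def sigmaStarR (d n R : ℕ) (F : Fin R → MvPolynomial (Fin n) ℝ) : ℕ :=
  sigmaStar d n R fun ρ => (F ρ).map (algebraMap ℝ ℂ)

/-- σ* for a system with integer coefficients. -/
def sigmaStarZ (d n R : ℕ) (F : Fin R → MvPolynomial (Fin n) ℤ) : ℕ :=
  sigmaStar d n R fun ρ => (F ρ).map (Int.castRingHom ℂ)

/-- `‖f^{[d]}‖`. -/
def normFd (d n : ℕ) (f : MvPolynomial (Fin n) ℝ) : ℝ :=
  (d.factorial : ℝ)⁻¹ * ⨆ j : Fin d → Fin n, |eval (0 : Fin n → ℝ) (iterPderiv (List.ofFn j) f)|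

/-- `N^aux_f(B)`. -/
def Naux (d n : ℕ) (g : MvPolynomial (Fin n) ℝ) (B : ℝ) : ℕ :=
  Set.ncard {x : Fin (d - 1) → Fin n → ℤ |
    (∀ k, ‖(fun i => (x k i : ℝ))‖ ≤ B) ∧
    ‖mForm d n g (fun k i => (x k i : ℝ))‖ < normFd d n g * B ^ (d - 2)}

end

open Topology in
/-- If at `(β₀, y₀)` the pencil `∑ ρ, β ρ • M ρ` is either nonzero or has `r` linearly independent
partial derivatives, then near that point its size controls the distance between any two points
differing only in `r` suitable coordinates. -/
lemma exists_nhds_norm_sub_le {κ : Type*} [Fintype κ] [DecidableEq κ] [Nonempty κ] {n R r : ℕ}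
    (hr : r ≤ n) (M : Fin R → ContinuousMultilinearMap ℝ (fun _ : κ => Fin n → ℝ) (Fin n → ℝ))
    (β₀ : Fin R → ℝ) (y₀ : κ → Fin n → ℝ)
    (h : (∑ ρ, β₀ ρ • M ρ) y₀ = 0 → ∃ S : Finset (κ × Fin n), S.card = r ∧
      LinearIndependent ℝ fun s : S =>
        (∑ ρ, β₀ ρ • M ρ) (Function.update y₀ s.1.1 (Pi.single s.1.2 1))) :
    ∃ S : Finset (κ × Fin n), S.card = r ∧ ∃ C > 0, ∃ U ∈ 𝓝 (β₀, y₀), ∀ β y y',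
      (β, y) ∈ U → (β, y') ∈ U → (∀ k l, (k, l) ∉ S → y k l = y' k l) →
      ‖y - y'‖ ≤ C * max ‖(∑ ρ, β ρ • M ρ) y‖ ‖(∑ ρ, β ρ • M ρ) y'‖ := by
  set F : (Fin R → ℝ) × (κ → Fin n → ℝ) → Fin n → ℝ := fun p => (∑ ρ, p.1 ρ • M ρ) p.2 with hF
  have hFs : ContDiff ℝ 1 F := by
    have : F = fun p => ∑ ρ, p.1 ρ • M ρ p.2 := by
      funext p; simp [hF]
    rw [this]
    refine ContDiff.sum fun ρ _ => ?_
    have h1 : ContDiff ℝ 1 fun p : (Fin R → ℝ) × (κ → Fin n → ℝ) => p.1 ρ := by fun_prop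
    exact h1.smul ((M ρ).contDiff.comp contDiff_snd)
  by_cases h0 : F (β₀, y₀) = 0
  · obtain ⟨S, hS, hli⟩ := h h0
    refine ⟨S, hS, ?_⟩
    set E := ∑ ρ, β₀ ρ • M ρ with hE
    have hd := hFs.contDiffAt.hasStrictFDerivAt (x := (β₀, y₀)) one_ne_zero
    set F' := fderiv ℝ F (β₀, y₀)
    have hpart : ∀ v, F' (0, v) = E.linearDeriv y₀ v := by
      intro v
      have h1 : HasFDerivAt (fun y => F (β₀, y)) (F'.comp (.inr ℝ _ _)) y₀ :=
        hd.hasFDerivAt.comp y₀ (hasFDerivAt_prodMk_right β₀ y₀)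
      have h2 : HasFDerivAt (fun y => F (β₀, y)) (E.linearDeriv y₀) y₀ := E.hasFDerivAt y₀
      have := DFunLike.congr_fun (h1.unique h2) v
      simpa using this
    set A := Fintype.linearCombination ℝ
      fun s : S => E (Function.update y₀ s.1.1 (Pi.single s.1.2 1)) with hA
    obtain ⟨K, hK, hAK⟩ := A.exists_antilipschitzWith
      (LinearMap.ker_eq_bot.2 (linearIndependent_iff_injective_fintypeLinearCombination.1 hli))
    have hlow : ∀ v : κ → Fin n → ℝ, (∀ k l, (k, l) ∉ S → v k l = 0) →
        ‖v‖ ≤ K * ‖F' (0, v)‖ := by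
      intro v hv
      have e1 : F' (0, v) = A (fun s => v s.1.1 s.1.2) := by
        rw [hpart, ContinuousMultilinearMap.linearDeriv_apply, hA,
          Fintype.linearCombination_apply]
        have : ∀ k, E (Function.update y₀ k (v k)) =
            ∑ l, v k l • E (Function.update y₀ k (Pi.single l 1)) := by
          intro k
          conv_lhs => rw [pi_eq_sum_univ' (v k)]
          exact (map_sum (E.toMultilinearMap.toLinearMap y₀ k) _ _).trans
            (Finset.sum_congr rfl fun l _ => E.map_update_smul _ _ _ _)
        simp_rw [this]
        rw [← Fintype.sum_prod_type'
          (f := fun k l => v k l • E (Function.update y₀ k (Pi.single l 1)))]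
        rw [Finset.univ_eq_attach, Finset.sum_attach S
          (fun s => v s.1 s.2 • E (Function.update y₀ s.1 (Pi.single s.2 1)))]
        refine (Finset.sum_subset (Finset.subset_univ S) fun s _ hs => ?_).symm
        rw [hv s.1 s.2 hs, zero_smul]
      have e2 : ‖v‖ ≤ ‖fun s : S => v s.1.1 s.1.2‖ := by
        refine (pi_norm_le_iff_of_nonneg (norm_nonneg _)).2 fun k =>
          (pi_norm_le_iff_of_nonneg (norm_nonneg _)).2 fun l => ?_
        by_cases hkl : (k, l) ∈ S
        · exact norm_le_pi_norm (fun s : S => v s.1.1 s.1.2) ⟨(k, l), hkl⟩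
        · rw [hv k l hkl, norm_zero]; exact norm_nonneg _
      rw [e1]
      exact e2.trans (by simpa [dist_eq_norm] using hAK.le_mul_dist (fun s => v s.1.1 s.1.2) 0)
    have hK' : (0 : ℝ) < K := hK
    have hsmall := hd.isLittleO.def (c := 1 / (2 * K)) (by positivity)
    rw [nhds_prod_eq] at hsmall
    obtain ⟨U, hU, hUs⟩ := Filter.mem_prod_self_iff.1 hsmall
    refine ⟨4 * K, by positivity, U, hU, fun β y y' hy hy' hyy => ?_⟩
    have h1 := hUs (Set.mk_mem_prod hy hy')
    simp only [Set.mem_ofPred_eq, Prod.mk_sub_mk, sub_self] at h1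
    have h2 := hlow (y - y') fun k l hkl => by simp [hyy k l hkl]
    have h3 : ‖((0 : Fin R → ℝ), y - y')‖ = ‖y - y'‖ := by simp [Prod.norm_def]
    rw [h3] at h1
    have h4 : ‖F' (0, y - y')‖ ≤
        ‖F (β, y)‖ + ‖F (β, y')‖ + ‖F (β, y) - F (β, y') - F' (0, y - y')‖ := by
      have : F' (0, y - y') =
          F (β, y) - F (β, y') - (F (β, y) - F (β, y') - F' (0, y - y')) := by abel
      calc _ = ‖F (β, y) - F (β, y') - (F (β, y) - F (β, y') - F' (0, y - y'))‖ := by rw [← this]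
        _ ≤ _ := (norm_sub_le _ _).trans (by gcongr; exact norm_sub_le _ _)
    have h5 : (K : ℝ) * (1 / (2 * K) * ‖y - y'‖) = ‖y - y'‖ / 2 := by field_simp
    have h6 : ‖y - y'‖ ≤ K * (‖F (β, y)‖ + ‖F (β, y')‖) + ‖y - y'‖ / 2 := by
      rw [← h5, ← mul_add]
      exact h2.trans (by gcongr; linarith)
    have h7 := le_max_left ‖F (β, y)‖ ‖F (β, y')‖
    have h8 := le_max_right ‖F (β, y)‖ ‖F (β, y')‖
    change _ ≤ 4 * K * max ‖F (β, y)‖ ‖F (β, y')‖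
    nlinarith
  · obtain ⟨S, -, hS⟩ := Finset.exists_subset_card_eq
      (s := (Finset.univ : Finset (κ × Fin n))) (n := r) (by
        simp only [Finset.card_univ, Fintype.card_prod, Fintype.card_fin]
        exact hr.trans (Nat.le_mul_of_pos_left _ Fintype.card_pos))
    have hpos : 0 < ‖F (β₀, y₀)‖ := norm_pos_iff.2 h0
    refine ⟨S, hS, 2 / ‖F (β₀, y₀)‖, by positivity,
      {p | ‖F (β₀, y₀)‖ / 2 < ‖F p‖} ∩ {p | dist p (β₀, y₀) < 1 / 2}, Filter.inter_mem ?_ ?_, ?_⟩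
    · exact (hFs.continuous.norm.tendsto _).eventually_const_lt (by linarith)
    · exact Metric.ball_mem_nhds _ (by norm_num)
    · rintro β y y' ⟨hy, hy1⟩ ⟨hy', hy1'⟩ -
      have h1 : ‖y - y'‖ ≤ 1 := by
        have h2 : dist y y₀ ≤ dist (β, y) (β₀, y₀) := le_max_right _ _
        have h3 : dist y' y₀ ≤ dist (β, y') (β₀, y₀) := le_max_right _ _
        rw [← dist_eq_norm]
        have := dist_triangle_right y y' y₀
        simp only [Set.mem_ofPred_eq] at hy1 hy1'
        linarith
      refine h1.trans ?_
      rw [div_mul_eq_mul_div, le_div_iff₀ hpos]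
      have h7 := le_max_left ‖F (β, y)‖ ‖F (β, y')‖
      simp only [Set.mem_ofPred_eq] at hy
      change _ ≤ 2 * max ‖F (β, y)‖ ‖F (β, y')‖
      linarith

/-- A set of integer points in a box whose members are confined to short intervals in the
coordinates in `S` once the remaining coordinates are fixed. -/
lemma ncard_le_prod_of_fibers {ι : Type*} [Fintype ι] [DecidableEq ι] (X : Set (ι → ℤ))
    (S : Finset ι) (c : ι → ℕ) (hout : ∀ x ∈ X, ∀ i ∉ S, |x i| ≤ c i)
    (hin : ∀ x ∈ X, ∀ x' ∈ X, (∀ i ∉ S, x i = x' i) → ∀ i ∈ S, |x i - x' i| ≤ c i) :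
    X.ncard ≤ ∏ i, (2 * c i + 1) := by
  classical
  let mask : (ι → ℤ) → ι → ℤ := fun x i => if i ∈ S then 0 else x i
  have hex : ∀ z : ι → ℤ, ∃ g : ι → ℤ, ∀ x ∈ X, mask x = z → g ∈ X ∧ mask g = z := by
    intro z
    by_cases h : ∃ x ∈ X, mask x = z
    · obtain ⟨x, hx⟩ := h
      exact ⟨x, fun _ _ _ => hx⟩
    · exact ⟨0, fun x hx hz => (h ⟨x, hx, hz⟩).elim⟩
  choose g hg using hex
  have hgmask : ∀ x ∈ X, ∀ i ∉ S, x i = g (mask x) i := by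
    intro x hx i hi
    have := congrFun (hg _ x hx rfl).2 i
    simpa [mask, hi] using this.symm
  have hcard : (((Fintype.piFinset fun i => Finset.Icc (-(c i : ℤ)) (c i)) : Finset (ι → ℤ)) :
      Set (ι → ℤ)).ncard = ∏ i, (2 * c i + 1) := by
    rw [Set.ncard_coe_finset, Fintype.card_piFinset]
    refine Finset.prod_congr rfl fun i _ => ?_
    rw [Int.card_Icc]
    omega
  rw [← hcard]
  refine Set.ncard_le_ncard_of_injOn (fun x i => if i ∈ S then x i - g (mask x) i else x i)
    ?_ ?_ (Finset.finite_toSet _)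
  · intro x hx
    simp only [Finset.mem_coe, Fintype.mem_piFinset, Finset.mem_Icc, ← abs_le]
    intro i
    split_ifs with hi
    · exact hin x hx _ (hg _ x hx rfl).1 (hgmask x hx) i hi
    · exact hout x hx i hi
  · intro x hx x' hx' hxx
    have hm : mask x = mask x' := by
      funext i
      have := congrFun hxx i
      by_cases hi : i ∈ S
      · simp [mask, hi]
      · simpa [mask, hi] using this
    funext i
    have := congrFun hxx i
    by_cases hi : i ∈ S
    · simpa [hi, hm] using this
    · simpa [hi] using this

lemma finite_setOf_forall_norm_le {κ : Type*} [Fintype κ] {n : ℕ} (b : κ → ℝ) :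
    {x : κ → Fin n → ℤ | ∀ k, ‖fun l => (x k l : ℝ)‖ ≤ b k}.Finite := by
  classical
  refine (Set.finite_Icc (fun k _ => -⌊b k⌋ : κ → Fin n → ℤ) (fun k _ => ⌊b k⌋)).subset ?_
  intro x hx
  have h : ∀ k l, |x k l| ≤ ⌊b k⌋ := fun k l => by
    rw [Int.le_floor]
    simpa using (norm_le_pi_norm (fun l => (x k l : ℝ)) l).trans (hx k)
  exact ⟨fun k l => (abs_le.1 (h k l)).1, fun k l => (abs_le.1 (h k l)).2⟩

/-- `ncard_le_prod_of_fibers` for boxes of sides `b k`, with the coordinates in `S` confined to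
intervals shorter by a factor `δ`. -/
lemma ncard_le_of_fibers {κ : Type*} [Fintype κ] [DecidableEq κ] {n : ℕ}
    (X : Set (κ → Fin n → ℤ)) (S : Finset (κ × Fin n)) {b : κ → ℝ} {δ C : ℝ} (hC : 0 ≤ C)
    (hb : ∀ k, 1 ≤ b k) (hδ : ∀ k, 1 ≤ δ * b k)
    (hX : ∀ x ∈ X, ∀ k, ‖fun l => (x k l : ℝ)‖ ≤ 2 * b k)
    (hin : ∀ x ∈ X, ∀ x' ∈ X, (∀ k l, (k, l) ∉ S → x k l = x' k l) →
      ∀ k l, |(x k l : ℝ) - x' k l| ≤ C * (δ * b k)) :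
    (X.ncard : ℝ) ≤ (2 * C + 5) ^ (Fintype.card κ * n) * (∏ k, b k) ^ n * δ ^ S.card := by
  classical
  let c : κ × Fin n → ℕ := fun i =>
    if i ∈ S then ⌊C * (δ * b i.1)⌋₊ else ⌊2 * b i.1⌋₊
  have hle : ∀ (a : ℝ), 0 ≤ a → ∀ z : ℤ, |(z : ℝ)| ≤ a → |z| ≤ (⌊a⌋₊ : ℤ) := by
    intro a ha z hz
    rw [Int.natCast_floor_eq_floor ha, Int.le_floor]
    simpa using hz
  have hb0 : ∀ k, 0 < b k := fun k => one_pos.trans_le (hb k)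
  have hcard : X.ncard ≤ ∏ i, (2 * c i + 1) := by
    rw [← Set.ncard_image_of_injective X
      (Function.uncurry_injective (α := κ) (β := Fin n) (γ := ℤ))]
    apply ncard_le_prod_of_fibers _ S
    · rintro _ ⟨x, hx, rfl⟩ ⟨k, l⟩ hi
      simp only [c, hi, if_false, Function.uncurry_apply_pair]
      refine hle _ (by linarith [hb k]) _ ?_
      simpa using (norm_le_pi_norm (fun l => (x k l : ℝ)) l).trans (hX x hx k)
    · rintro _ ⟨x, hx, rfl⟩ _ ⟨x', hx', rfl⟩ hxx ⟨k, l⟩ hi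
      simp only [c, hi, if_true, Function.uncurry_apply_pair]
      refine hle _ (mul_nonneg hC (by linarith [hδ k])) _ ?_
      simpa using hin x hx x' hx' (fun k l h => hxx (k, l) h) k l
  calc (X.ncard : ℝ) ≤ ∏ i, (2 * (c i : ℝ) + 1) := by exact_mod_cast hcard
    _ ≤ ∏ i : κ × Fin n, ((2 * C + 5) * b i.1) * if i ∈ S then δ else 1 := by
      refine Finset.prod_le_prod (fun i _ => by positivity) fun i _ => ?_
      have h1 := hb i.1
      have h2 := hδ i.1
      by_cases hi : i ∈ S
      · have := Nat.floor_le (mul_nonneg hC (by linarith : 0 ≤ δ * b i.1))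
        simp only [c, hi, if_true]
        nlinarith
      · have := Nat.floor_le (by linarith : 0 ≤ 2 * b i.1)
        simp only [c, hi, if_false]
        nlinarith
    _ = _ := by
      rw [Finset.prod_mul_distrib, Finset.prod_mul_distrib, Finset.prod_ite_mem,
        Finset.univ_inter, Finset.prod_const, Finset.prod_const, Finset.card_univ,
        Fintype.card_prod, Fintype.card_fin, Fintype.prod_prod_type]
      simp [Finset.prod_pow]

open Topology in
/-- The number of integer points with `x k` of size `b k` at which a normalised pencil is small. -/
lemma exists_ncard_box_le {κ : Type*} [Fintype κ] [DecidableEq κ] {n R r q : ℕ}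
    (hκ : Fintype.card κ = q + 1) (hr : r ≤ n)
    (M : Fin R → ContinuousMultilinearMap ℝ (fun _ : κ => Fin n → ℝ) (Fin n → ℝ))
    (h : ∀ β : Fin R → ℝ, β ≠ 0 → ∀ y : κ → Fin n → ℝ, (∀ k, y k ≠ 0) →
      (∑ ρ, β ρ • M ρ) y = 0 → ∃ S : Finset (κ × Fin n), S.card = r ∧
      LinearIndependent ℝ fun s : S =>
        (∑ ρ, β ρ • M ρ) (Function.update y s.1.1 (Pi.single s.1.2 1)))
    {D : ℝ} (hD : 0 ≤ D) :
    ∃ C : ℝ, 0 ≤ C ∧ ∀ β : Fin R → ℝ, ‖β‖ = 1 → ∀ (B : ℝ) (b : κ → ℝ),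
      (∀ k, 1 ≤ b k) → (∀ k, b k ≤ B) →
      (({x : κ → Fin n → ℤ | (∀ k, b k ≤ ‖fun l => (x k l : ℝ)‖ ∧
        ‖fun l => (x k l : ℝ)‖ ≤ 2 * b k) ∧
        ‖(∑ ρ, β ρ • M ρ) (fun k l => (x k l : ℝ))‖ ≤ D * B ^ q}).ncard : ℝ) ≤
        C * B ^ (q * n + (n - r)) := by
  have : Nonempty κ := Fintype.card_pos_iff.1 (by omega)
  let T : Set ((Fin R → ℝ) × (κ → Fin n → ℝ)) → (Fin R → ℝ) → ℝ → (κ → ℝ) →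
      Set (κ → Fin n → ℤ) := fun s β B b => {x | (∀ k, ‖fun l => (x k l : ℝ)‖ ≤ 2 * b k) ∧
        ‖(∑ ρ, β ρ • M ρ) (fun k l => (x k l : ℝ))‖ ≤ D * B ^ q ∧
        (β, fun k l => (b k)⁻¹ * (x k l : ℝ)) ∈ s}
  have hfin : ∀ s β B b, (T s β B b).Finite := fun s β B b =>
    (finite_setOf_forall_norm_le fun k => 2 * b k).subset fun x hx => hx.1
  let K : Set ((Fin R → ℝ) × (κ → Fin n → ℝ)) :=
    Metric.sphere 0 1 ×ˢ Set.univ.pi fun _ => {v | 1 ≤ ‖v‖} ∩ Metric.closedBall 0 2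
  have hK : IsCompact K := by
    refine (isCompact_sphere _ _).prod (isCompact_univ_pi fun _ => ?_)
    exact (isCompact_closedBall _ _).inter_left (isClosed_le continuous_const continuous_norm)
  have key : ∃ C : ℝ, 0 ≤ C ∧ ∀ (β : Fin R → ℝ) (B : ℝ) (b : κ → ℝ),
      (∀ k, 1 ≤ b k) → (∀ k, b k ≤ B) →
      ((T K β B b).ncard : ℝ) ≤ C * B ^ (q * n + (n - r)) := by
    refine hK.induction_on (p := fun s => ∃ C : ℝ, 0 ≤ C ∧ ∀ (β : Fin R → ℝ) (B : ℝ) (b : κ → ℝ),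
      (∀ k, 1 ≤ b k) → (∀ k, b k ≤ B) →
      ((T s β B b).ncard : ℝ) ≤ C * B ^ (q * n + (n - r))) ?_ ?_ ?_ ?_
    · exact ⟨0, le_rfl, fun β B b _ _ => by simp [T]⟩
    · rintro s t hst ⟨C, hC, H⟩
      refine ⟨C, hC, fun β B b h1 h2 => le_trans ?_ (H β B b h1 h2)⟩
      have : T s β B b ⊆ T t β B b := fun x hx => ⟨hx.1, hx.2.1, hst hx.2.2⟩
      exact_mod_cast Set.ncard_le_ncard this (hfin t β B b)
    · rintro s t ⟨C, hC, H⟩ ⟨C', hC', H'⟩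
      refine ⟨C + C', by positivity, fun β B b h1 h2 => ?_⟩
      have : T (s ∪ t) β B b ⊆ T s β B b ∪ T t β B b := fun x hx =>
        hx.2.2.imp (fun h => ⟨hx.1, hx.2.1, h⟩) (fun h => ⟨hx.1, hx.2.1, h⟩)
      have h3 : ((T (s ∪ t) β B b).ncard : ℝ) ≤ (T s β B b).ncard + (T t β B b).ncard := by
        exact_mod_cast (Set.ncard_le_ncard this ((hfin s β B b).union (hfin t β B b))).trans
          (Set.ncard_union_le _ _)
      rw [add_mul]
      exact h3.trans (add_le_add (H β B b h1 h2) (H' β B b h1 h2))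
    · rintro ⟨β₀, y₀⟩ ⟨hβ₀, hy₀⟩
      obtain ⟨S, hS, C, hC, U, hU, H⟩ := exists_nhds_norm_sub_le hr M β₀ y₀
        (h β₀ (ne_zero_of_mem_unit_sphere ⟨β₀, hβ₀⟩) y₀ fun k hk => by
          have := (hy₀ k trivial).1
          simp only [Set.mem_ofPred_eq, hk, norm_zero] at this
          linarith)
      refine ⟨U, mem_nhdsWithin_of_mem_nhds hU,
        (2 * (C * D) + 5) ^ (Fintype.card κ * n), by positivity, fun β B b h1 h2 => ?_⟩
      have hb0 : ∀ k, 0 < b k := fun k => one_pos.trans_le (h1 k)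
      have hB : 1 ≤ B := (h1 (Classical.arbitrary κ)).trans (h2 _)
      have hP : 0 < ∏ k, b k := Finset.prod_pos fun k _ => hb0 k
      set P := ∏ k, b k with hPdef
      have hPB : P ≤ B ^ (q + 1) := by
        rw [← hκ, hPdef, ← Finset.card_univ, ← Finset.prod_const]
        exact Finset.prod_le_prod (fun k _ => (hb0 k).le) fun k _ => h2 k
      have hδ : ∀ k, 1 ≤ B ^ q / P * b k := by
        intro k
        rw [div_mul_eq_mul_div, le_div_iff₀ hP, one_mul, hPdef,
          ← Finset.mul_prod_erase _ _ (Finset.mem_univ k), mul_comm]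
        gcongr
        · exact (hb0 k).le
        · have : (Finset.univ.erase k).card = q := by
            rw [Finset.card_erase_of_mem (Finset.mem_univ k), Finset.card_univ, hκ]; rfl
          rw [← this, ← Finset.prod_const]
          exact Finset.prod_le_prod (fun k _ => (hb0 k).le) fun k _ => h2 k
      have hscale : ∀ x : κ → Fin n → ℝ,
          ‖(∑ ρ, β ρ • M ρ) (fun k l => (b k)⁻¹ * x k l)‖ =
            P⁻¹ * ‖(∑ ρ, β ρ • M ρ) x‖ := by
        intro x
        have := (∑ ρ, β ρ • M ρ).map_smul_univ (fun k => (b k)⁻¹) x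
        rw [Finset.prod_inv_distrib] at this
        change ‖(∑ ρ, β ρ • M ρ) (fun k => (b k)⁻¹ • x k)‖ = _
        rw [this, norm_smul, norm_inv, Real.norm_of_nonneg hP.le]
      refine (ncard_le_of_fibers (T U β B b) S (by positivity : 0 ≤ C * D) h1 hδ
        (fun x hx => hx.1) ?_).trans ?_
      · intro x hx x' hx' hxx k l
        have h3 := H β _ _ hx.2.2 hx'.2.2 fun k l hkl => by rw [hxx k l hkl]
        have h4 : ∀ z ∈ T U β B b,
            ‖(∑ ρ, β ρ • M ρ) (fun k l => (b k)⁻¹ * (z k l : ℝ))‖ ≤ D * (B ^ q / P) := by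
          intro z hz
          rw [hscale, inv_mul_le_iff₀ hP]
          refine hz.2.1.trans_eq ?_
          field_simp
        have h5 := h3.trans (mul_le_mul_of_nonneg_left (max_le (h4 x hx) (h4 x' hx')) hC.le)
        have h6 := (norm_le_pi_norm _ l).trans ((norm_le_pi_norm _ k).trans h5)
        simp only [Pi.sub_apply] at h6
        rw [← mul_sub, norm_mul, norm_inv, Real.norm_of_nonneg (hb0 k).le,
          inv_mul_le_iff₀ (hb0 k), Real.norm_eq_abs] at h6
        linarith
      · rw [hS, mul_assoc]
        refine mul_le_mul_of_nonneg_left ?_ (by positivity)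
        calc P ^ n * (B ^ q / P) ^ r = P ^ (n - r) * B ^ (q * r) := by
              rw [div_pow, ← pow_mul, ← Nat.sub_add_cancel hr, pow_add]
              field_simp
              simp
          _ ≤ (B ^ (q + 1)) ^ (n - r) * B ^ (q * r) := by gcongr
          _ = _ := by
              rw [← pow_mul, ← pow_add]
              congr 1
              obtain ⟨m, rfl⟩ := Nat.exists_eq_add_of_le hr
              simp; ring
  obtain ⟨C, hC, H⟩ := key
  refine ⟨C, hC, fun β hβ B b h1 h2 => le_trans ?_ (H β B b h1 h2)⟩
  refine Nat.cast_le.2 (Set.ncard_le_ncard (fun x hx => ?_) (hfin K β B b))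
  refine ⟨fun k => (hx.1 k).2, hx.2, by simpa using hβ, fun k _ => ?_⟩
  have hb0 : 0 < b k := one_pos.trans_le (h1 k)
  have : ‖fun l => (b k)⁻¹ * (x k l : ℝ)‖ = (b k)⁻¹ * ‖fun l => (x k l : ℝ)‖ := by
    change ‖(b k)⁻¹ • fun l => (x k l : ℝ)‖ = _
    rw [norm_smul, norm_inv, Real.norm_of_nonneg hb0.le]
  simp only [Set.mem_inter_iff, Set.mem_ofPred_eq, mem_closedBall_zero_iff, this]
  rw [inv_mul_le_iff₀ hb0, le_inv_mul_iff₀ hb0]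
  exact ⟨by simpa using (hx.1 k).1, by linarith [(hx.1 k).2]⟩

lemma ncard_setOf_exists_eq_zero_le {κ : Type*} [Fintype κ] [DecidableEq κ] {n q : ℕ}
    (hκ : Fintype.card κ = q + 1) {B : ℝ} (hB : 1 ≤ B) (k₀ : κ) :
    (({x : κ → Fin n → ℤ | (∀ k, ‖fun l => (x k l : ℝ)‖ ≤ B) ∧ x k₀ = 0}).ncard : ℝ) ≤
      3 ^ (n * q) * B ^ (q * n) := by
  set X := {x : κ → Fin n → ℤ | (∀ k, ‖fun l => (x k l : ℝ)‖ ≤ B) ∧ x k₀ = 0} with hX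
  have h1 : X.ncard ≤ ∏ i : κ × Fin n, (2 * (if i.1 = k₀ then 0 else ⌊B⌋₊) + 1) := by
    rw [← Set.ncard_image_of_injective X
      (Function.uncurry_injective (α := κ) (β := Fin n) (γ := ℤ))]
    refine ncard_le_prod_of_fibers _ ∅ _ ?_ (by simp)
    rintro _ ⟨x, hx, rfl⟩ ⟨k, l⟩ -
    by_cases hk : k = k₀
    · simp [hk, hx.2]
    · simp only [hk, if_false, Function.uncurry_apply_pair]
      rw [Int.natCast_floor_eq_floor (by linarith), Int.le_floor]
      simpa using (norm_le_pi_norm (fun l => (x k l : ℝ)) l).trans (hx.1 k)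
  have h2 : ∏ i : κ × Fin n, (2 * (if i.1 = k₀ then 0 else ⌊B⌋₊) + 1) =
      ((2 * ⌊B⌋₊ + 1) ^ n) ^ q := by
    rw [Fintype.prod_prod_type]
    rw [← Finset.mul_prod_erase _ _ (Finset.mem_univ k₀)]
    have hq : (Finset.univ.erase k₀).card = q := by
      rw [Finset.card_erase_of_mem (Finset.mem_univ k₀), Finset.card_univ, hκ]; rfl
    have herase : ∏ k ∈ Finset.univ.erase k₀, ∏ _l : Fin n,
        (2 * (if k = k₀ then 0 else ⌊B⌋₊) + 1) = ((2 * ⌊B⌋₊ + 1) ^ n) ^ q := by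
      conv_rhs => rw [← hq, ← Finset.prod_const]
      exact Finset.prod_congr rfl fun k hk => by simp [Finset.ne_of_mem_erase hk]
    rw [herase]
    simp
  rw [h2, ← pow_mul] at h1
  have h3 : (2 * (⌊B⌋₊ : ℝ) + 1) ≤ 3 * B := by
    have := Nat.floor_le (by linarith : 0 ≤ B)
    linarith
  calc (X.ncard : ℝ) ≤ (2 * (⌊B⌋₊ : ℝ) + 1) ^ (n * q) := by exact_mod_cast h1
    _ ≤ (3 * B) ^ (n * q) := by gcongr
    _ = _ := by rw [mul_pow, mul_comm q n]

/-- Summing `exists_ncard_box_le` over dyadic boxes. -/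
lemma exists_ncard_le_log {κ : Type*} [Fintype κ] [DecidableEq κ] {n R r q : ℕ}
    (hκ : Fintype.card κ = q + 1) (hr : r ≤ n)
    (M : Fin R → ContinuousMultilinearMap ℝ (fun _ : κ => Fin n → ℝ) (Fin n → ℝ))
    (h : ∀ β : Fin R → ℝ, β ≠ 0 → ∀ y : κ → Fin n → ℝ, (∀ k, y k ≠ 0) →
      (∑ ρ, β ρ • M ρ) y = 0 → ∃ S : Finset (κ × Fin n), S.card = r ∧
      LinearIndependent ℝ fun s : S =>
        (∑ ρ, β ρ • M ρ) (Function.update y s.1.1 (Pi.single s.1.2 1)))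
    {D : ℝ} (hD : 0 ≤ D) :
    ∃ C : ℝ, 0 ≤ C ∧ ∀ β : Fin R → ℝ, ‖β‖ = 1 → ∀ B : ℝ, 1 ≤ B →
      (({x : κ → Fin n → ℤ | (∀ k, ‖fun l => (x k l : ℝ)‖ ≤ B) ∧
        ‖(∑ ρ, β ρ • M ρ) (fun k l => (x k l : ℝ))‖ ≤ D * B ^ q}).ncard : ℝ) ≤
        C * ((Nat.log 2 ⌊B⌋₊ : ℝ) + 1) ^ (q + 1) * B ^ (q * n + (n - r)) := by
  obtain ⟨C, hC, H⟩ := exists_ncard_box_le hκ hr M h hD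
  refine ⟨(q + 1) * 3 ^ (n * q) + C, by positivity, fun β hβ B hB => ?_⟩
  set L := Nat.log 2 ⌊B⌋₊
  set X := {x : κ → Fin n → ℤ | (∀ k, ‖fun l => (x k l : ℝ)‖ ≤ B) ∧
        ‖(∑ ρ, β ρ • M ρ) (fun k l => (x k l : ℝ))‖ ≤ D * B ^ q} with hX
  let Z : κ → Set (κ → Fin n → ℤ) := fun k₀ =>
    {x | (∀ k, ‖fun l => (x k l : ℝ)‖ ≤ B) ∧ x k₀ = 0}
  let Y : (κ → Fin (L + 1)) → Set (κ → Fin n → ℤ) := fun j =>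
    {x | (∀ k, (2 : ℝ) ^ (j k : ℕ) ≤ ‖fun l => (x k l : ℝ)‖ ∧
        ‖fun l => (x k l : ℝ)‖ ≤ 2 * 2 ^ (j k : ℕ)) ∧
        ‖(∑ ρ, β ρ • M ρ) (fun k l => (x k l : ℝ))‖ ≤ D * B ^ q}
  have hZfin : ∀ k, (Z k).Finite := fun k =>
    (finite_setOf_forall_norm_le fun _ => B).subset fun x hx => hx.1
  have hYfin : ∀ j, (Y j).Finite := fun j =>
    (finite_setOf_forall_norm_le fun k => 2 * 2 ^ (j k : ℕ)).subset fun x hx k => (hx.1 k).2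
  have hfl : ⌊B⌋₊ ≠ 0 := (Nat.floor_pos.2 hB).ne'
  have hsub : X ⊆ (⋃ k, Z k) ∪ ⋃ j, Y j := by
    intro x hx
    by_cases h0 : ∃ k, x k = 0
    · obtain ⟨k, hk⟩ := h0
      exact Or.inl (Set.mem_iUnion.2 ⟨k, hx.1, hk⟩)
    · push Not at h0
      right
      have hj : ∀ k, ∃ j : Fin (L + 1), (2 : ℝ) ^ (j : ℕ) ≤ ‖fun l => (x k l : ℝ)‖ ∧
          ‖fun l => (x k l : ℝ)‖ ≤ 2 * 2 ^ (j : ℕ) := by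
        intro k
        set t := ‖fun l => (x k l : ℝ)‖ with ht
        have ht1 : 1 ≤ t := by
          obtain ⟨l, hl⟩ := Function.ne_iff.1 (h0 k)
          refine le_trans ?_ (norm_le_pi_norm (fun l => (x k l : ℝ)) l)
          have : (1 : ℤ) ≤ |x k l| := Int.one_le_abs hl
          rw [Real.norm_eq_abs]
          exact_mod_cast this
        have ht0 : ⌊t⌋₊ ≠ 0 := (Nat.floor_pos.2 ht1).ne'
        refine ⟨⟨Nat.log 2 ⌊t⌋₊, Nat.lt_succ_of_le
          (Nat.log_mono_right (Nat.floor_mono (hx.1 k)))⟩, ?_, ?_⟩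
        · refine le_trans ?_ (Nat.floor_le (by linarith : 0 ≤ t))
          exact_mod_cast Nat.pow_log_le_self 2 ht0
        · refine (Nat.lt_floor_add_one t).le.trans ?_
          have := Nat.lt_pow_succ_log_self (b := 2) one_lt_two ⌊t⌋₊
          have h2 : ⌊t⌋₊ + 1 ≤ 2 * 2 ^ Nat.log 2 ⌊t⌋₊ := by rw [← pow_succ']; exact this
          exact_mod_cast h2
      choose j hj using hj
      exact Set.mem_iUnion.2 ⟨j, hj, hx.2⟩
  have hcard : (X.ncard : ℝ) ≤ ∑ k, ((Z k).ncard : ℝ) + ∑ j, ((Y j).ncard : ℝ) := by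
    have h1 := (Set.ncard_le_ncard hsub
      ((Set.finite_iUnion hZfin).union (Set.finite_iUnion hYfin))).trans (Set.ncard_union_le _ _)
    exact_mod_cast h1.trans (add_le_add (Set.ncard_iUnion_le_of_fintype _)
      (Set.ncard_iUnion_le_of_fintype _))
  have hZ : ∑ k, ((Z k).ncard : ℝ) ≤ (q + 1) * (3 ^ (n * q) * B ^ (q * n)) := by
    refine (Finset.sum_le_card_nsmul _ _ _ fun k _ =>
      ncard_setOf_exists_eq_zero_le hκ hB k).trans_eq ?_
    rw [Finset.card_univ, hκ, nsmul_eq_mul]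
    push_cast
    rfl
  have hY : ∑ j, ((Y j).ncard : ℝ) ≤ ((L : ℝ) + 1) ^ (q + 1) * (C * B ^ (q * n + (n - r))) := by
    refine (Finset.sum_le_card_nsmul _ _ _ fun j _ => H β hβ B (fun k => 2 ^ (j k : ℕ))
      (fun k => one_le_pow₀ one_le_two) fun k => ?_).trans_eq ?_
    · refine le_trans ?_ (Nat.floor_le (by linarith : 0 ≤ B))
      have h1 : 2 ^ (j k : ℕ) ≤ ⌊B⌋₊ :=
        (Nat.pow_le_pow_right two_pos (Nat.lt_succ_iff.1 (j k).2)).trans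
          (Nat.pow_log_le_self 2 hfl)
      exact_mod_cast h1
    · rw [Finset.card_univ, Fintype.card_fun, hκ, Fintype.card_fin, nsmul_eq_mul]
      push_cast
      rfl
  have hL : 1 ≤ ((L : ℝ) + 1) ^ (q + 1) := one_le_pow₀ (by linarith [L.cast_nonneg (α := ℝ)])
  have hBB : B ^ (q * n) ≤ B ^ (q * n + (n - r)) := pow_le_pow_right₀ hB (Nat.le_add_right _ _)
  have hfinal : (q + 1) * (3 ^ (n * q) * B ^ (q * n)) ≤
      (q + 1) * 3 ^ (n * q) * ((L : ℝ) + 1) ^ (q + 1) * B ^ (q * n + (n - r)) := by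
    calc (q + 1) * (3 ^ (n * q) * B ^ (q * n))
        = (q + 1) * 3 ^ (n * q) * 1 * B ^ (q * n) := by ring
      _ ≤ _ := by gcongr
  linarith

lemma exists_natLog_add_one_pow_le (m : ℕ) :
    ∃ C : ℝ, 0 ≤ C ∧ ∀ B : ℝ, 1 ≤ B →
      ((Nat.log 2 ⌊B⌋₊ : ℝ) + 1) ^ m ≤ C * B ^ (1 / 2 : ℝ) := by
  set ε : ℝ := 1 / (2 * (m + 1)) with hε
  have hε0 : 0 < ε := by positivity
  have hlog2 : 0 < Real.log 2 := Real.log_pos one_lt_two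
  refine ⟨(1 / (ε * Real.log 2) + 1) ^ m, by positivity, fun B hB => ?_⟩
  have hB0 : 0 < B := by linarith
  have h1 : (Nat.log 2 ⌊B⌋₊ : ℝ) + 1 ≤ (1 / (ε * Real.log 2) + 1) * B ^ ε := by
    have h2 : (Nat.log 2 ⌊B⌋₊ : ℝ) ≤ Real.log B / Real.log 2 := by
      refine (Real.natLog_le_logb _ _).trans ?_
      rw [Real.logb, Nat.cast_ofNat]
      gcongr
      · exact_mod_cast Nat.floor_pos.2 hB
      · exact Nat.floor_le hB0.le
    have h3 : Real.log B / Real.log 2 ≤ 1 / (ε * Real.log 2) * B ^ ε := by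
      rw [div_le_iff₀ hlog2]
      refine (Real.log_le_rpow_div hB0.le hε0).trans_eq ?_
      field_simp
    have h4 : 1 ≤ B ^ ε := Real.one_le_rpow hB hε0.le
    linarith
  calc _ ≤ ((1 / (ε * Real.log 2) + 1) * B ^ ε) ^ m := by gcongr
    _ = (1 / (ε * Real.log 2) + 1) ^ m * B ^ (ε * m) := by
      rw [mul_pow, ← Real.rpow_mul_natCast hB0.le]
    _ ≤ _ := by
      gcongr
      rw [hε, one_div_mul_eq_div, div_le_div_iff₀ (by positivity) two_pos]
      linarith

section mForm

variable {n : ℕ} {K : Type*} [CommSemiring K]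

lemma iterPderiv_sum_smul {R : ℕ} (js : List (Fin n)) (β : Fin R → K)
    (f : Fin R → MvPolynomial (Fin n) K) :
    iterPderiv js (∑ ρ, β ρ • f ρ) = ∑ ρ, β ρ • iterPderiv js (f ρ) := by
  induction js with
  | nil => rfl
  | cons j js ih =>
    change pderiv j (iterPderiv js _) = ∑ ρ, β ρ • pderiv j (iterPderiv js (f ρ))
    rw [ih, map_sum]
    simp

lemma iterPderiv_map {K' : Type*} [CommSemiring K'] (φ : K →+* K') (js : List (Fin n))
    (g : MvPolynomial (Fin n) K) : iterPderiv js (g.map φ) = (iterPderiv js g).map φ := by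
  induction js with
  | nil => rfl
  | cons j js ih =>
    change pderiv j (iterPderiv js _) = (pderiv j (iterPderiv js g)).map φ
    rw [ih, pderiv_map]

/-- Every coefficient of an iterated derivative is a multiple of a single coefficient. -/
lemma exists_coeff_iterPderiv (js : List (Fin n)) (m : Fin n →₀ ℕ) :
    ∃ (c : K) (m' : Fin n →₀ ℕ), m'.degree = m.degree + js.length ∧
      ∀ g : MvPolynomial (Fin n) K, coeff m (iterPderiv js g) = coeff m' g * c := by
  induction js generalizing m with
  | nil => exact ⟨1, m, rfl, fun g => (mul_one _).symm⟩
  | cons j js ih =>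
    obtain ⟨c, m', hm', hc⟩ := ih (m + Finsupp.single j 1)
    refine ⟨c * (m j + 1), m', ?_, fun g => ?_⟩
    · rw [hm', map_add, Finsupp.degree_single, List.length_cons]
      ring
    · change coeff m (pderiv j (iterPderiv js g)) = _
      rw [coeff_pderiv, hc, mul_assoc]

lemma eval_zero_iterPderiv_homogeneousComponent (js : List (Fin n))
    (g : MvPolynomial (Fin n) K) :
    eval 0 (iterPderiv js (homogeneousComponent js.length g)) = eval 0 (iterPderiv js g) := by
  obtain ⟨c, m, hm, hc⟩ := exists_coeff_iterPderiv (K := K) js 0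
  rw [eval_zero, constantCoeff_eq, hc, hc, coeff_homogeneousComponent, if_pos]
  simpa using hm

lemma mForm_homogeneousComponent {d : ℕ} (hd : 1 ≤ d) (g : MvPolynomial (Fin n) K)
    (x : Fin (d - 1) → Fin n → K) :
    mForm d n (homogeneousComponent d g) x = mForm d n g x := by
  funext i
  refine Finset.sum_congr rfl fun j _ => congrArg _ ?_
  have := eval_zero_iterPderiv_homogeneousComponent (i :: List.ofFn j) g
  rwa [List.length_cons, List.length_ofFn, Nat.sub_add_cancel hd] at this

lemma mForm_sum_smul {R : ℕ} (d : ℕ) (β : Fin R → K) (f : Fin R → MvPolynomial (Fin n) K)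
    (x : Fin (d - 1) → Fin n → K) :
    mForm d n (∑ ρ, β ρ • f ρ) x = ∑ ρ, β ρ • mForm d n (f ρ) x := by
  funext i
  simp only [mForm, iterPderiv_sum_smul, map_sum, Derivation.map_smul, smul_eval, Finset.sum_apply,
    Pi.smul_apply, smul_eq_mul, Finset.mul_sum]
  rw [Finset.sum_comm]
  exact Finset.sum_congr rfl fun _ _ => Finset.sum_congr rfl fun _ _ => by ring

lemma mForm_map {K' : Type*} [CommSemiring K'] (φ : K →+* K') (d : ℕ)
    (g : MvPolynomial (Fin n) K) (x : Fin (d - 1) → Fin n → K) (i : Fin n) :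
    mForm d n (g.map φ) (fun k l => φ (x k l)) i = φ (mForm d n g x i) := by
  have h : ∀ p : MvPolynomial (Fin n) K, eval 0 (p.map φ) = φ (eval 0 p) := fun p => by
    simp only [eval_zero, constantCoeff_map]
  simp only [mForm, iterPderiv_map, pderiv_map, h, map_sum, map_mul, map_prod]

end mForm

/-- `mForm` as a continuous multilinear map. -/
noncomputable def mFormContinuous (d n : ℕ) (g : MvPolynomial (Fin n) ℝ) :
    ContinuousMultilinearMap ℝ (fun _ : Fin (d - 1) => Fin n → ℝ) (Fin n → ℝ) :=
  ∑ j : Fin (d - 1) → Fin n,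
    ((ContinuousMultilinearMap.mkPiAlgebra ℝ (Fin (d - 1)) ℝ).compContinuousLinearMap
      fun k => ContinuousLinearMap.proj (R := ℝ) (φ := fun _ : Fin n => ℝ) (j k)).smulRight
        fun i => eval 0 (pderiv i (iterPderiv (List.ofFn j) g))

lemma mFormContinuous_apply (d n : ℕ) (g : MvPolynomial (Fin n) ℝ)
    (x : Fin (d - 1) → Fin n → ℝ) : mFormContinuous d n g x = mForm d n g x := by
  funext i
  simp [mFormContinuous, mForm, Finset.sum_apply]

lemma sum_smul_mFormContinuous_apply {R : ℕ} (d n : ℕ) (β : Fin R → ℝ)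
    (f : Fin R → MvPolynomial (Fin n) ℝ) (x : Fin (d - 1) → Fin n → ℝ) :
    (∑ ρ, β ρ • mFormContinuous d n (f ρ)) x = mForm d n (∑ ρ, β ρ • f ρ) x := by
  simp [mForm_sum_smul, mFormContinuous_apply]

lemma Matrix.exists_linearIndependent_col_of_le_rank {m ι K : Type*} [Fintype m] [Fintype ι]
    [Field K] (A : Matrix m ι K) {r : ℕ} (hr : r ≤ A.rank) :
    ∃ S : Finset ι, S.card = r ∧ LinearIndependent K fun s : S => A.col s := by
  classical
  obtain ⟨κ, a, ha, hsp, hli⟩ := exists_linearIndependent' K A.col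
  have : Fintype κ := Fintype.ofInjective a ha
  have hcard : (Finset.univ.map ⟨a, ha⟩).card = A.rank := by
    rw [Matrix.rank_eq_finrank_span_cols, ← hsp, finrank_span_eq_card hli, Finset.card_map,
      Finset.card_univ]
  obtain ⟨S, hS, hSr⟩ := Finset.exists_subset_card_eq (hr.trans_eq hcard.symm)
  have hS' : ∀ s : S, ∃ t, a t = s := fun s => by
    simpa using hS s.2
  choose g hg using hS'
  refine ⟨S, hSr, ?_⟩
  have hginj : Function.Injective g := fun s t hst => by
    apply Subtype.ext
    rw [← hg s, ← hg t, hst]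
  have hcol : (fun s : S => A.col s) = (A.col ∘ a) ∘ g := funext fun s => by simp [hg]
  rw [hcol]
  exact hli.comp g hginj

lemma le_rank_jacMat_of_sigmaStar_le {d n R s : ℕ} {H : Fin R → MvPolynomial (Fin n) ℂ}
    (hσ : sigmaStar d n R H ≤ s) {β : Fin R → ℂ} (hβ : β ≠ 0) {x : Fin (d - 1) → Fin n → ℂ}
    (hx : ∀ k, x k ≠ 0) (h0 : mForm d n (∑ ρ, β ρ • H ρ) x = 0) :
    n - s ≤ (jacMat d n (∑ ρ, β ρ • H ρ) x).rank := by
  have h1 : n - (jacMat d n (∑ ρ, β ρ • H ρ) x).rank ≤ sigmaStar d n R H := by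
    refine le_csSup ⟨n, ?_⟩ ⟨β, hβ, x, hx, h0, rfl⟩
    rintro _ ⟨_, _, _, _, _, rfl⟩
    exact Nat.sub_le _ _
  omega

lemma exists_linearIndependent_of_sigmaStarR_le {d n R s : ℕ} (hd : 1 ≤ d)
    (f : Fin R → MvPolynomial (Fin n) ℝ)
    (hσ : sigmaStarR d n R (fun ρ => homogeneousComponent d (f ρ)) ≤ s)
    {β : Fin R → ℝ} (hβ : β ≠ 0) {y : Fin (d - 1) → Fin n → ℝ} (hy : ∀ k, y k ≠ 0)
    (h0 : mForm d n (∑ ρ, β ρ • f ρ) y = 0) :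
    ∃ S : Finset (Fin (d - 1) × Fin n), S.card = n - s ∧ LinearIndependent ℝ fun t : S =>
      mForm d n (∑ ρ, β ρ • f ρ) (Function.update y t.1.1 (Pi.single t.1.2 1)) := by
  have hmap : ∀ x : Fin (d - 1) → Fin n → ℝ, ∀ i,
      mForm d n (∑ ρ, (β ρ : ℂ) • (homogeneousComponent d (f ρ)).map (algebraMap ℝ ℂ))
        (fun k l => (x k l : ℂ)) i = ((mForm d n (∑ ρ, β ρ • f ρ) x i : ℝ) : ℂ) := by
    intro x i
    have e1 := fun ρ => mForm_map (algebraMap ℝ ℂ) d (homogeneousComponent d (f ρ)) x i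
    simp only [mForm_homogeneousComponent hd, Complex.coe_algebraMap] at e1
    simp only [mForm_sum_smul, Finset.sum_apply, Pi.smul_apply, smul_eq_mul, Complex.ofReal_sum,
      Complex.ofReal_mul, ← e1]
  have hrank := le_rank_jacMat_of_sigmaStar_le hσ (β := fun ρ => (β ρ : ℂ))
    (x := fun k l => (y k l : ℂ))
    (fun h => hβ (funext fun ρ => by simpa using congrFun h ρ))
    (fun k h => hy k (funext fun l => by simpa using congrFun h l))
    (funext fun i => by rw [hmap, h0]; simp)
  obtain ⟨S, hS, hli⟩ := Matrix.exists_linearIndependent_col_of_le_rank _ hrank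
  refine ⟨S, hS, ?_⟩
  have hliR : LinearIndependent ℝ fun t : S => Matrix.col (jacMat d n
      (∑ ρ, (β ρ : ℂ) • (homogeneousComponent d (f ρ)).map (algebraMap ℝ ℂ))
      fun k l => (y k l : ℂ)) t :=
    hli.restrict_scalars' ℝ
  refine LinearIndependent.of_comp (LinearMap.compLeft Complex.ofRealCLM.toLinearMap (Fin n)) ?_
  convert hliR using 1
  funext t i
  change ((mForm d n _ _ i : ℝ) : ℂ) = mForm d n _ _ i
  rw [← hmap]
  congr 1
  funext k l
  by_cases hk : k = t.1.1
  · subst hk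
    by_cases hl : l = t.1.2
    · subst hl; simp
    · simp [hl]
  · simp [hk]

lemma normFd_nonneg (d n : ℕ) (g : MvPolynomial (Fin n) ℝ) : 0 ≤ normFd d n g :=
  mul_nonneg (by positivity) (Real.iSup_nonneg fun _ => abs_nonneg _)

lemma exists_normFd_le (d n R : ℕ) (f : Fin R → MvPolynomial (Fin n) ℝ) :
    ∃ D : ℝ, 0 ≤ D ∧ ∀ β : Fin R → ℝ, normFd d n (∑ ρ, β ρ • f ρ) ≤ D * ‖β‖ := by
  refine ⟨∑ ρ, normFd d n (f ρ), Finset.sum_nonneg fun ρ _ => normFd_nonneg d n _, fun β => ?_⟩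
  simp only [normFd]
  rw [← Finset.mul_sum, mul_assoc]
  refine mul_le_mul_of_nonneg_left ?_ (by positivity)
  refine Real.iSup_le (fun j => ?_) (mul_nonneg (Finset.sum_nonneg fun ρ _ =>
    Real.iSup_nonneg fun _ => abs_nonneg _) (norm_nonneg _))
  rw [iterPderiv_sum_smul, map_sum, Finset.sum_mul]
  refine (Finset.abs_sum_le_sum_abs _ _).trans (Finset.sum_le_sum fun ρ _ => ?_)
  rw [smul_eval, abs_mul, mul_comm]
  exact mul_le_mul
    (le_ciSup (f := fun j : Fin d → Fin n => |eval 0 (iterPderiv (List.ofFn j) (f ρ))|)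
      (Set.finite_range _).bddAbove j)
    (norm_le_pi_norm β ρ) (abs_nonneg _) (Real.iSup_nonneg fun _ => abs_nonneg _)

lemma exists_Naux_le {d R n s : ℕ} (hd : 2 ≤ d) (hs : s ≤ n)
    (f : Fin R → MvPolynomial (Fin n) ℝ)
    (hσ : sigmaStarR d n R (fun ρ => homogeneousComponent d (f ρ)) ≤ s) :
    ∃ C : ℝ, 0 < C ∧ ∀ (β : Fin R → ℝ) (B : ℝ), 1 ≤ B →
      (Naux d n (∑ ρ, β ρ • f ρ) B : ℝ) ≤ C * (B ^ (1 / 2 : ℝ) * B ^ ((d - 2) * n + s)) := by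
  obtain ⟨D, hD, hDf⟩ := exists_normFd_le d n R f
  obtain ⟨C₁, hC₁, H₁⟩ := exists_ncard_le_log (κ := Fin (d - 1)) (q := d - 2) (r := n - s)
    (by rw [Fintype.card_fin]; omega) (Nat.sub_le _ _) (fun ρ => mFormContinuous d n (f ρ))
    (fun β hβ y hy h0 => by
      simp only [sum_smul_mFormContinuous_apply] at h0 ⊢
      exact exists_linearIndependent_of_sigmaStarR_le (by omega) f hσ hβ hy h0) hD
  obtain ⟨C₂, hC₂, H₂⟩ := exists_natLog_add_one_pow_le (d - 2 + 1)
  rw [Nat.sub_sub_self hs] at H₁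
  refine ⟨C₁ * C₂ + 1, by positivity, fun β B hB => ?_⟩
  by_cases hβ : β = 0
  · have hempty : Naux d n (∑ ρ, β ρ • f ρ) B = 0 := by
      have h0 : normFd d n (∑ ρ, β ρ • f ρ) * B ^ (d - 2) ≤ 0 :=
        mul_nonpos_of_nonpos_of_nonneg (by simpa [hβ] using hDf β) (by positivity)
      rw [← Set.ncard_empty (Fin (d - 1) → Fin n → ℤ)]
      exact congrArg Set.ncard (Set.eq_empty_of_forall_notMem fun x hx =>
        (hx.2.trans_le h0).not_ge (norm_nonneg _))
    rw [hempty, Nat.cast_zero]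
    positivity
  · have hβ0 : 0 < ‖β‖ := norm_pos_iff.2 hβ
    let Y : Set (Fin (d - 1) → Fin n → ℤ) := {x | (∀ k, ‖fun l => (x k l : ℝ)‖ ≤ B) ∧
      ‖(∑ ρ, (‖β‖⁻¹ • β) ρ • mFormContinuous d n (f ρ)) (fun k l => (x k l : ℝ))‖ ≤
        D * B ^ (d - 2)}
    have hsub : (Naux d n (∑ ρ, β ρ • f ρ) B : ℝ) ≤ Y.ncard := by
      refine Nat.cast_le.2 (Set.ncard_le_ncard (fun x hx => ⟨hx.1, ?_⟩)
        ((finite_setOf_forall_norm_le fun _ => B).subset fun x hx => hx.1))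
      have h1 : (∑ ρ, (‖β‖⁻¹ • β) ρ • mFormContinuous d n (f ρ)) (fun k l => (x k l : ℝ)) =
          ‖β‖⁻¹ • mForm d n (∑ ρ, β ρ • f ρ) (fun k l => (x k l : ℝ)) := by
        rw [sum_smul_mFormContinuous_apply, mForm_sum_smul, mForm_sum_smul, Finset.smul_sum]
        simp only [Pi.smul_apply, smul_assoc]
      rw [h1, norm_smul, norm_inv, norm_norm, inv_mul_le_iff₀ hβ0]
      refine hx.2.le.trans ?_
      calc _ ≤ D * ‖β‖ * B ^ (d - 2) := by gcongr; exact hDf β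
        _ = _ := by ring
    refine (hsub.trans (H₁ _ (norm_smul_inv_norm hβ) B hB)).trans ?_
    calc _ ≤ C₁ * (C₂ * B ^ (1 / 2 : ℝ)) * B ^ ((d - 2) * n + s) := by gcongr; exact H₂ B hB
      _ = C₁ * C₂ * (B ^ (1 / 2 : ℝ) * B ^ ((d - 2) * n + s)) := by ring
      _ ≤ _ := by gcongr; linarith

/-- With `𝒞 = (n - R + 1/2)/2^d` one has `𝒞 > dR`, and the
auxiliary count satisfies `N^aux_{β·f}(B) ≪ B^{(d-1)n - 2^d 𝒞}`. -/
theorem statement12 (d R n : ℕ) (hd : 2 ≤ d) (hR : 1 ≤ R)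
    (hn : d * 2 ^ d * R + R < n)
    (f : Fin R → MvPolynomial (Fin n) ℝ)
    (hdeg : ∀ ρ, (f ρ).totalDegree = d)
    (hσ : sigmaStarR d n R (fun ρ => MvPolynomial.homogeneousComponent d (f ρ)) ≤ R - 1) :
    (d * R : ℝ) < ((n : ℝ) - R + 1 / 2) / 2 ^ d ∧
    ∃ C : ℝ, 0 < C ∧ ∀ (β : Fin R → ℝ) (B : ℝ), 2 ≤ B →
      (Naux d n (∑ ρ, β ρ • f ρ) B : ℝ) ≤
        C * B ^ (((d : ℝ) - 1) * n - 2 ^ d * (((n : ℝ) - R + 1 / 2) / 2 ^ d)) := by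
  refine ⟨?_, ?_⟩
  · rw [lt_div_iff₀ (by positivity)]
    have : (d : ℝ) * 2 ^ d * R + R < n := by exact_mod_cast hn
    linarith
  · have hRn : R ≤ n := by omega
    obtain ⟨C, hC, H⟩ := exists_Naux_le hd (by omega : R - 1 ≤ n) f hσ
    refine ⟨C, hC, fun β B hB => (H β B (by linarith)).trans_eq ?_⟩
    have hB0 : 0 < B := by linarith
    rw [← Real.rpow_natCast, ← Real.rpow_add hB0]
    congr 2
    push_cast [Nat.cast_sub hd, Nat.cast_sub hR]
    field_simp
    ring
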